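/- arXiv:1608.01714 — 2 statements merged into one kernel-verified Lean document; each statement's English description precedes it below -/
import Mathlib

section
/- Let p be a prime and u ≥ 0 an integer, and let G be a finite abelian p-group. For each n ≥ 1, let μ_n denote the Haar probability measure on the space of (n+u) × n matrices with entries in the ring ℤ_p of p-adic integers. Then the limit as n → ∞ of the μ_n-probability that the cokernel of a random matrix M (i.e., ℤ_p^{n+u} / (M·ℤ_p^n)) is isomorphic as a ℤ_p-module to ℤ_p^u ⊕ G equals (∏_{i=1}^{∞} (1 − p^{−i−u})) / (|G|^u · |Aut G|). -/
open MeasureTheory Filter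

noncomputable instance (p : ℕ) [Fact p.Prime] : MeasurableSpace ℤ_[p] := borel _
instance (p : ℕ) [Fact p.Prime] : BorelSpace ℤ_[p] := ⟨rfl⟩

instance (p : ℕ) [Fact p.Prime] (m n : ℕ) :
    CompactSpace (Matrix (Fin m) (Fin n) ℤ_[p]) :=
  (inferInstance : CompactSpace (Fin m → Fin n → ℤ_[p]))

noncomputable instance (p : ℕ) [Fact p.Prime] (m n : ℕ) :
    MeasurableSpace (Matrix (Fin m) (Fin n) ℤ_[p]) :=
  (inferInstance : MeasurableSpace (Fin m → Fin n → ℤ_[p]))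

instance (p : ℕ) [Fact p.Prime] (m n : ℕ) :
    BorelSpace (Matrix (Fin m) (Fin n) ℤ_[p]) :=
  (inferInstance : BorelSpace (Fin m → Fin n → ℤ_[p]))

/-- The Haar probability measure on the compact additive group of `m × n` matrices
over the `p`-adic integers, normalized so that the total space has measure `1`. -/
noncomputable def padicMatrixHaar (p : ℕ) [Fact p.Prime] (m n : ℕ) :
    Measure (Matrix (Fin m) (Fin n) ℤ_[p]) :=
  Measure.addHaarMeasure ⟨⟨Set.univ, isCompact_univ⟩, by
    rw [interior_univ]; exact Set.univ_nonempty⟩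

open scoped Matrix

/-- Every coordinate vector is attained by pairing with a basis under the dot product. -/
theorem exists_forall_basis_dotProduct_eq {R : Type*} [CommRing R] {ι : Type*} [Fintype ι]
    [DecidableEq ι] (b : Module.Basis ι R (ι → R)) (w : ι → R) :
    ∃ z : ι → R, ∀ i, b i ⬝ᵥ z = w i := by
  obtain ⟨z, hz⟩ := (dotProductEquiv R ι).surjective (b.constr R w)
  refine ⟨z, fun i => ?_⟩
  have h := congrArg (fun l => l (b i)) hz
  simpa [dotProduct_comm] using h

theorem eq_of_forall_basis_dotProduct_eq {R : Type*} [CommRing R] {ι : Type*} [Fintype ι]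
    [DecidableEq ι] (b : Module.Basis ι R (ι → R)) {y z : ι → R}
    (h : ∀ i, b i ⬝ᵥ y = b i ⬝ᵥ z) : y = z := by
  apply (dotProductEquiv R ι).injective
  refine b.ext fun i => ?_
  simpa [dotProduct_comm] using h i

/-- The Smith normal form of an injective matrix. -/
theorem Matrix.exists_bases_mulVec_eq_smul {R : Type*} [CommRing R] [IsDomain R]
    [IsPrincipalIdealRing R] {m n : ℕ} (M : Matrix (Fin m) (Fin n) R)
    (hM : Function.Injective M.mulVecLin) :
    ∃ (b : Module.Basis (Fin m) R (Fin m → R)) (c : Module.Basis (Fin n) R (Fin n → R))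
      (f : Fin n ↪ Fin m) (a : Fin n → R), ∀ i, M *ᵥ c i = a i • b (f i) := by
  obtain ⟨k, b, bN, f, a, h⟩ := Submodule.smithNormalForm (Pi.basisFun R (Fin m))
    (LinearMap.range M.mulVecLin)
  let e := LinearEquiv.ofInjective M.mulVecLin hM
  have hk : k = n := by
    have h1 := Module.finrank_eq_card_basis (bN.map e.symm)
    simpa using h1.symm
  subst hk
  refine ⟨b, bN.map e.symm, f, a, fun i => ?_⟩
  rw [← h i]
  exact congrArg Subtype.val (e.apply_symm_apply (bN i))

/-- The cokernel of an injective matrix is the sum of a free module and the cokernel of its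
transpose, and the latter is torsion. -/
theorem Matrix.nonempty_cokernel_equiv_prod_cokernel_transpose {R : Type*} [CommRing R]
    [IsDomain R] [IsPrincipalIdealRing R] {n u : ℕ} (M : Matrix (Fin (n + u)) (Fin n) R)
    (hM : Function.Injective M.mulVecLin) :
    Nonempty (((Fin (n + u) → R) ⧸ LinearMap.range M.mulVecLin) ≃ₗ[R]
      ((Fin u → R) × ((Fin n → R) ⧸ LinearMap.range Mᵀ.mulVecLin))) ∧
    Module.IsTorsion R ((Fin n → R) ⧸ LinearMap.range Mᵀ.mulVecLin) := by
  classical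
  obtain ⟨b, c, f, a, h⟩ := M.exists_bases_mulVec_eq_smul hM
  have ha : ∀ i, a i ≠ 0 := by
    intro i hi
    have h1 : M.mulVecLin (c i) = M.mulVecLin 0 := by simp [h, hi]
    exact c.ne_zero i (hM h1)
  let S := {j : Fin (n + u) // j ∉ Set.range f}
  let φ : (Fin (n + u) → R) →ₗ[R] (S → R) × (∀ i, R ⧸ Ideal.span {a i}) :=
    LinearMap.prod (LinearMap.pi fun j => b.coord j)
      (LinearMap.pi fun i => (Submodule.mkQ (Ideal.span {a i})).comp (b.coord (f i)))
  let ψ : (Fin n → R) →ₗ[R] (∀ i, R ⧸ Ideal.span {a i}) :=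
    LinearMap.pi fun i => (Submodule.mkQ (Ideal.span {a i})).comp (dotProductEquiv R (Fin n) (c i))
  have hφ₁ : ∀ x j, (φ x).1 j = b.repr x j := fun _ _ => rfl
  have hφ₂ : ∀ x i, (φ x).2 i = Submodule.mkQ (Ideal.span {a i}) (b.repr x (f i)) :=
    fun _ _ => rfl
  have hφs : Function.Surjective φ := by
    rintro ⟨s, t⟩
    choose t' ht using fun i => Submodule.mkQ_surjective (Ideal.span {a i}) (t i)
    let w : Fin (n + u) → R := fun j =>
      if hj : j ∈ Set.range f then t' hj.choose else s ⟨j, hj⟩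
    have hw : ∀ i, w (f i) = t' i := fun i => by
      have hj : f i ∈ Set.range f := ⟨i, rfl⟩
      simp only [w, dif_pos hj]
      rw [f.injective hj.choose_spec]
    refine ⟨b.equivFun.symm w, ?_⟩
    ext j
    · obtain ⟨j, hj⟩ := j
      have : b.repr (b.equivFun.symm w) j = w j := by
        rw [← b.equivFun_apply, LinearEquiv.apply_symm_apply]
      rw [hφ₁, this]
      exact dif_neg hj
    · have : b.repr (b.equivFun.symm w) (f j) = t' j := by
        rw [← b.equivFun_apply, LinearEquiv.apply_symm_apply, hw]
      rw [hφ₂, this, ht]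
  have hφk : LinearMap.ker φ = LinearMap.range M.mulVecLin := by
    apply le_antisymm
    · intro x hx
      have hx' : φ x = 0 := hx
      have h1 : ∀ j ∉ Set.range f, b.repr x j = 0 := fun j hj =>
        congrFun (congrArg Prod.fst hx') ⟨j, hj⟩
      have h2 : ∀ i, ∃ r, b.repr x (f i) = a i * r := fun i => by
        have h3 : Submodule.mkQ (Ideal.span {a i}) (b.repr x (f i)) = 0 :=
          congrFun (congrArg Prod.snd hx') i
        rw [Submodule.mkQ_apply, Submodule.Quotient.mk_eq_zero, Ideal.mem_span_singleton] at h3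
        exact h3
      choose r hr using h2
      refine ⟨∑ i, r i • c i, ?_⟩
      have : x = ∑ j, b.repr x j • b j := (b.sum_repr x).symm
      rw [this, ← Finset.sum_subset (Finset.subset_univ (Finset.univ.map f)), Finset.sum_map]
      · simp [h, hr, smul_smul, mul_comm]
      · intro j _ hj
        rw [h1 j (by simpa using hj), zero_smul]
    · rintro _ ⟨y, rfl⟩
      have hy : y = ∑ i, c.repr y i • c i := (c.sum_repr y).symm
      rw [hy, map_sum]
      refine Submodule.sum_mem _ fun i _ => ?_
      rw [map_smul]
      refine Submodule.smul_mem _ _ ?_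
      rw [LinearMap.mem_ker, Matrix.mulVecLin_apply, h]
      ext j
      · obtain ⟨j, hj⟩ := j
        have : f i ≠ j := fun h' => hj ⟨i, h'⟩
        simp [hφ₁, this]
      · rw [hφ₂, Prod.snd_zero, Pi.zero_apply, Submodule.mkQ_apply,
          Submodule.Quotient.mk_eq_zero, Ideal.mem_span_singleton]
        by_cases hij : i = j
        · subst hij; simp
        · simp [f.injective.ne hij]
  have hψs : Function.Surjective ψ := by
    intro t
    choose t' ht using fun i => Submodule.mkQ_surjective (Ideal.span {a i}) (t i)
    obtain ⟨z, hz⟩ := exists_forall_basis_dotProduct_eq c t'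
    refine ⟨z, ?_⟩
    ext i
    simp only [ψ, LinearMap.pi_apply, LinearMap.comp_apply, dotProductEquiv_apply_apply, hz, ht]
  have hadj : ∀ i z, c i ⬝ᵥ (Mᵀ *ᵥ z) = a i * (b (f i) ⬝ᵥ z) := fun i z => by
    rw [Matrix.mulVec_transpose, dotProduct_comm, ← Matrix.dotProduct_mulVec, h, dotProduct_comm,
      smul_dotProduct, smul_eq_mul]
  have hψk : ∀ y, (∀ i, a i ∣ c i ⬝ᵥ y) → y ∈ LinearMap.range Mᵀ.mulVecLin := by
    intro y hy
    choose r hr using hy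
    obtain ⟨z, hz⟩ := exists_forall_basis_dotProduct_eq b
      (fun j => if hj : j ∈ Set.range f then r hj.choose else 0)
    refine ⟨z, eq_of_forall_basis_dotProduct_eq c fun i => ?_⟩
    have hj : f i ∈ Set.range f := ⟨i, rfl⟩
    rw [Matrix.mulVecLin_apply, hadj, hz, dif_pos hj, f.injective hj.choose_spec, hr]
  have hψk' : LinearMap.ker ψ = LinearMap.range Mᵀ.mulVecLin := by
    apply le_antisymm
    · intro y hy
      refine hψk y fun i => ?_
      have h3 : Submodule.mkQ (Ideal.span {a i}) (c i ⬝ᵥ y) = 0 := congrFun hy i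
      rwa [Submodule.mkQ_apply, Submodule.Quotient.mk_eq_zero, Ideal.mem_span_singleton] at h3
    · rintro _ ⟨z, rfl⟩
      rw [LinearMap.mem_ker]
      ext i
      simp only [ψ, LinearMap.pi_apply, LinearMap.comp_apply, dotProductEquiv_apply_apply,
        Matrix.mulVecLin_apply, hadj, Pi.zero_apply]
      rw [Submodule.mkQ_apply, Submodule.Quotient.mk_eq_zero, Ideal.mem_span_singleton]
      exact dvd_mul_right _ _
  constructor
  · have hcard : Fintype.card S = Fintype.card (Fin u) := by
      have h1 : Fintype.card {j // j ∈ Set.range f} = n := by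
        rw [← Fintype.card_congr (Equiv.ofInjective f f.injective), Fintype.card_fin]
      have h2 := Fintype.card_subtype_compl (fun j => j ∈ Set.range f)
      rw [h1] at h2
      simpa [S] using h2
    let e1 := (Submodule.quotEquivOfEq _ _ hφk.symm).trans (φ.quotKerEquivOfSurjective hφs)
    let e2 := (Submodule.quotEquivOfEq _ _ hψk'.symm).trans (ψ.quotKerEquivOfSurjective hψs)
    exact ⟨e1.trans (LinearEquiv.prodCongr
      (LinearEquiv.funCongrLeft R R (Fintype.equivOfCardEq hcard).symm) e2.symm)⟩
  · intro x
    obtain ⟨y, rfl⟩ := Submodule.Quotient.mk_surjective _ x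
    refine ⟨⟨∏ i, a i, mem_nonZeroDivisors_of_ne_zero (Finset.prod_ne_zero_iff.2 fun i _ => ha i)⟩,
      ?_⟩
    rw [Submonoid.mk_smul]
    rw [← Submodule.Quotient.mk_smul, Submodule.Quotient.mk_eq_zero]
    refine hψk _ fun i => ?_
    rw [dotProduct_smul, smul_eq_mul]
    exact (Finset.dvd_prod_of_mem a (Finset.mem_univ i)).mul_right _

theorem LinearMap.fst_apply_eq_zero_of_isTorsion {R : Type*} [CommRing R] [IsDomain R]
    {ι A B : Type*} [AddCommGroup A] [Module R A] [AddCommGroup B] [Module R B]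
    (hA : Module.IsTorsion R A) (e : ((ι → R) × A) →ₗ[R] ((ι → R) × B)) (x : A) :
    (e (0, x)).1 = 0 := by
  obtain ⟨r, hr⟩ := @hA x
  have hr' : (r : R) • x = 0 := hr
  have h : (r : R) • (e (0, x)).1 = 0 := by
    rw [← Prod.smul_fst, ← map_smul, Prod.smul_mk, hr', smul_zero]
    exact congrArg Prod.fst (map_zero e)
  funext i
  have hi := congrFun h i
  simp only [Pi.smul_apply, smul_eq_mul, Pi.zero_apply, mul_eq_zero] at hi
  exact hi.resolve_left (nonZeroDivisors.ne_zero r.2)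

/-- Torsion summands may be compared after cancelling a free summand. -/
theorem nonempty_linearEquiv_of_prod_pi {R : Type*} [CommRing R] [IsDomain R] {ι A B : Type*}
    [AddCommGroup A] [Module R A] [AddCommGroup B] [Module R B] (hA : Module.IsTorsion R A)
    (hB : Module.IsTorsion R B) (e : ((ι → R) × A) ≃ₗ[R] ((ι → R) × B)) :
    Nonempty (A ≃ₗ[R] B) := by
  refine ⟨LinearEquiv.ofBijective
    ((LinearMap.snd R (ι → R) B).comp (e.toLinearMap.comp (LinearMap.inr R (ι → R) A))) ⟨?_, ?_⟩⟩
  · rw [← LinearMap.ker_eq_bot, LinearMap.ker_eq_bot']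
    intro x hx
    have h1 := e.toLinearMap.fst_apply_eq_zero_of_isTorsion hA x
    have h2 : e (0, x) = 0 := Prod.ext h1 hx
    simpa using h2
  · intro y
    have h1 := e.symm.toLinearMap.fst_apply_eq_zero_of_isTorsion hB y
    refine ⟨(e.symm (0, y)).2, ?_⟩
    have h2 : ((0 : ι → R), (e.symm (0, y)).2) = e.symm (0, y) := Prod.ext h1.symm rfl
    simp [h2]

theorem Module.IsTorsion.of_finite {R G : Type*} [CommRing R] [IsDomain R] [CharZero R]
    [AddCommGroup G] [Module R G] [Finite G] : Module.IsTorsion R G := by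
  intro x
  refine ⟨⟨(Nat.card G : R), mem_nonZeroDivisors_of_ne_zero
    (Nat.cast_ne_zero.2 Nat.card_pos.ne')⟩, ?_⟩
  change (Nat.card G : R) • x = 0
  rw [Nat.cast_smul_eq_nsmul]
  exact card_nsmul_eq_zero'

theorem Matrix.nonempty_cokernel_equiv_iff {R : Type*} [CommRing R] [IsDomain R]
    [IsPrincipalIdealRing R] [CharZero R] {n u : ℕ} (M : Matrix (Fin (n + u)) (Fin n) R)
    (G : Type*) [AddCommGroup G] [Module R G] [Finite G] :
    Nonempty (((Fin (n + u) → R) ⧸ LinearMap.range M.mulVecLin) ≃ₗ[R] ((Fin u → R) × G)) ↔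
      Nonempty (((Fin n → R) ⧸ LinearMap.range Mᵀ.mulVecLin) ≃ₗ[R] G) := by
  have hG : Module.IsTorsion R G := .of_finite
  constructor
  · rintro ⟨e⟩
    have hM : Function.Injective M.mulVecLin := by
      have h1 := Submodule.finrank_quotient_add_finrank (LinearMap.range M.mulVecLin)
      have h2 := Submodule.finrank_quotient_add_finrank (LinearMap.ker M.mulVecLin)
      have : Module.Finite R G := Module.Finite.of_finite
      have h3 := Submodule.finrank_quotient_add_finrank
        (LinearMap.ker (LinearMap.fst R (Fin u → R) G))
      have h4 : Module.finrank R (LinearMap.ker (LinearMap.fst R (Fin u → R) G)) = 0 := by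
        apply Module.IsTorsion.finrank_eq_zero
        rintro ⟨⟨x, g⟩, hx⟩
        obtain ⟨r, hr⟩ := @hG g
        refine ⟨r, Subtype.ext (Prod.ext ?_ hr)⟩
        have : x = 0 := hx
        simp [this]
      have h5 := ((LinearMap.fst R (Fin u → R) G).quotKerEquivOfSurjective
        Prod.fst_surjective).finrank_eq
      have h6 := M.mulVecLin.quotKerEquivRange.finrank_eq
      have h7 := e.finrank_eq
      simp only [Module.finrank_fin_fun] at h1 h2 h5
      have h8 : Module.finrank R (LinearMap.ker M.mulVecLin) = 0 := by omega
      rw [← LinearMap.ker_eq_bot]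
      exact Submodule.finrank_eq_zero.1 h8
    obtain ⟨⟨e'⟩, ht⟩ := M.nonempty_cokernel_equiv_prod_cokernel_transpose hM
    exact nonempty_linearEquiv_of_prod_pi ht hG (e'.symm.trans e)
  · rintro ⟨e⟩
    have hM : Function.Injective M.mulVecLin := by
      rw [← LinearMap.ker_eq_bot, LinearMap.ker_eq_bot']
      intro x hx
      refine dotProduct_eq_zero x fun y => ?_
      have hy : (Nat.card G : R) • y ∈ LinearMap.range Mᵀ.mulVecLin := by
        rw [← Submodule.Quotient.mk_eq_zero, Submodule.Quotient.mk_smul]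
        apply e.injective
        rw [map_smul, map_zero, Nat.cast_smul_eq_nsmul]
        exact card_nsmul_eq_zero'
      obtain ⟨z, hz⟩ := hy
      have h1 : (Nat.card G : R) * (x ⬝ᵥ y) = 0 := by
        rw [← smul_eq_mul, ← dotProduct_smul, ← hz, Matrix.mulVecLin_apply,
          Matrix.mulVec_transpose, dotProduct_comm, ← Matrix.dotProduct_mulVec]
        rw [Matrix.mulVecLin_apply] at hx
        rw [hx, dotProduct_zero]
      exact (mul_eq_zero.1 h1).resolve_left (Nat.cast_ne_zero.2 Nat.card_pos.ne')
    obtain ⟨⟨e'⟩, -⟩ := M.nonempty_cokernel_equiv_prod_cokernel_transpose hM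
    exact ⟨e'.trans (LinearEquiv.prodCongr (LinearEquiv.refl R _) e)⟩

theorem tendsto_card_span_eq_top_div (R G : Type*) [CommRing R] [AddCommGroup G] [Module R G]
    [Finite G] :
    Tendsto (fun n : ℕ => (Nat.card {g : Fin n → G // Submodule.span R (Set.range g) = ⊤} : ℝ) /
      (Nat.card G : ℝ) ^ n) atTop (nhds 1) := by
  classical
  have : Finite (Submodule R G) := Finite.of_injective _ SetLike.coe_injective
  have := Fintype.ofFinite {H : Submodule R G // H ≠ ⊤}
  have hG : (0 : ℝ) < Nat.card G := Nat.cast_pos.2 Nat.card_pos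
  have hlim : Tendsto (fun n : ℕ => 1 - ∑ H : {H : Submodule R G // H ≠ ⊤},
      ((Nat.card H.1 : ℝ) / Nat.card G) ^ n) atTop (nhds 1) := by
    have : Tendsto (fun n : ℕ => 1 - ∑ H : {H : Submodule R G // H ≠ ⊤},
        ((Nat.card H.1 : ℝ) / Nat.card G) ^ n) atTop
        (nhds (1 - ∑ _H : {H : Submodule R G // H ≠ ⊤}, (0 : ℝ))) := by
      refine tendsto_const_nhds.sub (tendsto_finsetSum _ fun H _ => ?_)
      refine tendsto_pow_atTop_nhds_zero_of_lt_one (by positivity) ?_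
      rw [div_lt_one hG, Nat.cast_lt]
      refine lt_of_le_of_ne (Nat.card_le_card_of_injective _ Subtype.val_injective) fun h => H.2 ?_
      have h1 := (Nat.bijective_iff_injective_and_card (Subtype.val : H.1 → G)).2
        ⟨Subtype.val_injective, h⟩
      refine eq_top_iff.2 fun x _ => ?_
      obtain ⟨y, rfl⟩ := h1.2 x
      exact y.2
    simpa using this
  refine tendsto_of_tendsto_of_tendsto_of_le_of_le hlim tendsto_const_nhds (fun n => ?_)
    fun n => ?_
  · have hsplit : Nat.card {g : Fin n → G // Submodule.span R (Set.range g) = ⊤} +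
        Nat.card {g : Fin n → G // Submodule.span R (Set.range g) ≠ ⊤} = Nat.card G ^ n := by
      rw [← Nat.card_sum, Nat.card_congr (Equiv.sumCompl _), Nat.card_fun, Nat.card_fin]
    have hbad : Nat.card {g : Fin n → G // Submodule.span R (Set.range g) ≠ ⊤} ≤
        ∑ H : {H : Submodule R G // H ≠ ⊤}, Nat.card H.1 ^ n := by
      have h1 : ∀ H : {H : Submodule R G // H ≠ ⊤},
          Nat.card H.1 ^ n = Nat.card (Fin n → H.1) := fun H => by
        rw [Nat.card_fun, Nat.card_fin]
      simp_rw [h1]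
      rw [← Nat.card_sigma]
      refine Nat.card_le_card_of_injective (fun g => ⟨⟨_, g.2⟩, fun i =>
        ⟨g.1 i, Submodule.subset_span ⟨i, rfl⟩⟩⟩) ?_
      intro g g' h
      have h2 := congrArg (fun x : (Σ H : {H : Submodule R G // H ≠ ⊤}, Fin n → H.1) =>
        fun i => (x.2 i : G)) h
      exact Subtype.ext h2
    have hsplit' : (Nat.card {g : Fin n → G // Submodule.span R (Set.range g) = ⊤} : ℝ) +
        Nat.card {g : Fin n → G // Submodule.span R (Set.range g) ≠ ⊤} = (Nat.card G : ℝ) ^ n := by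
      exact_mod_cast hsplit
    have hbad' : (Nat.card {g : Fin n → G // Submodule.span R (Set.range g) ≠ ⊤} : ℝ) ≤
        ∑ H : {H : Submodule R G // H ≠ ⊤}, (Nat.card H.1 : ℝ) ^ n := by
      exact_mod_cast hbad
    simp_rw [div_pow]
    rw [le_div_iff₀ (by positivity), ← Finset.sum_div, sub_mul, div_mul_cancel₀ _ (by positivity)]
    linarith
  · rw [div_le_one (by positivity)]
    have := Nat.card_le_card_of_injective (Subtype.val : {g : Fin n → G //
      Submodule.span R (Set.range g) = ⊤} → Fin n → G) Subtype.val_injective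
    rw [Nat.card_fun, Nat.card_fin] at this
    rw [← Nat.cast_pow]
    exact Nat.cast_le.2 this

/-- The preimage of a set under a surjection from a probability space with invariant measure onto
a finite group has the normalized counting measure. -/
theorem measureReal_preimage_of_surjective {A B : Type*} [AddGroup A] [MeasurableSpace A]
    [MeasurableAdd A] [AddGroup B] [Finite B] (μ : Measure A) [IsProbabilityMeasure μ]
    [μ.IsAddLeftInvariant] (π : A →+ B) (hπ : Function.Surjective π)
    (hmeas : ∀ b, MeasurableSet (π ⁻¹' {b})) (S : Set B) :
    μ.real (π ⁻¹' S) = Nat.card S / Nat.card B := by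
  classical
  have := Fintype.ofFinite B
  have hfib : ∀ b, μ.real (π ⁻¹' {b}) = μ.real (π ⁻¹' {0}) := by
    intro b
    obtain ⟨a, rfl⟩ := hπ b
    rw [measureReal_def, measureReal_def, ← measure_preimage_add μ a (π ⁻¹' {π a})]
    congr 2
    ext x
    simp
  have hsum : ∀ T : Set B, μ.real (π ⁻¹' T) = Nat.card T * μ.real (π ⁻¹' {0}) := by
    intro T
    have h1 : π ⁻¹' T = ⋃ b ∈ T.toFinset, π ⁻¹' {b} := by ext x; simp
    rw [h1, measureReal_biUnion_finset]
    · simp [hfib]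
    · intro b _ c _ hbc
      exact Disjoint.preimage π (by simpa using hbc)
    · exact fun b _ => hmeas b
  have huniv := hsum Set.univ
  rw [Set.preimage_univ, probReal_univ, Nat.card_univ] at huniv
  have hB : (Nat.card B : ℝ) ≠ 0 := Nat.cast_ne_zero.2 Nat.card_pos.ne'
  rw [hsum S, eq_div_iff hB, mul_assoc, mul_comm (μ.real _), ← huniv, mul_one]

theorem AddEquiv.map_padicInt_smul {p : ℕ} [Fact p.Prime] {G : Type*} [AddCommGroup G]
    [Module ℤ_[p] G] {k : ℕ} (hG : Nat.card G = p ^ k) (f : G ≃+ G) (r : ℤ_[p]) (x : G) :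
    f (r • x) = r • f x := by
  have key : ∀ y : G, r • y = r.appr k • y := by
    intro y
    have h := PadicInt.appr_spec k r
    rw [Ideal.mem_span_singleton] at h
    obtain ⟨s, hs⟩ := h
    have h0 : ((p : ℤ_[p]) ^ k) • y = 0 := by
      rw [← Nat.cast_pow, ← hG, Nat.cast_smul_eq_nsmul]
      exact card_nsmul_eq_zero'
    rw [← Nat.cast_smul_eq_nsmul ℤ_[p], ← sub_eq_zero, ← sub_smul, hs, mul_comm, mul_smul, h0,
      smul_zero]
  rw [key, key, map_nsmul]

/-- The surjections from a finite free module with a prescribed kernel form a torsor under the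
automorphisms of the target. -/
theorem card_surjections_with_kernel {R G : Type*} [CommRing R] [AddCommGroup G] [Module R G]
    {n : ℕ} (N : Submodule R (Fin n → R)) (e : ((Fin n → R) ⧸ N) ≃ₗ[R] G) :
    Nat.card {g : Fin n → G // Submodule.span R (Set.range g) = ⊤ ∧
      N = LinearMap.ker (Fintype.linearCombination R g)} = Nat.card (G ≃ₗ[R] G) := by
  classical
  have hF : ∀ F : (Fin n → R) →ₗ[R] G,
      Fintype.linearCombination R (fun i => F (Pi.single i 1)) = F := by
    intro F
    refine LinearMap.pi_ext' fun i => LinearMap.ext_ring ?_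
    simp
  symm
  refine Nat.card_congr (Equiv.ofBijective (fun σ => ⟨fun i => σ (e (N.mkQ (Pi.single i 1))),
    ?_⟩) ⟨?_, ?_⟩)
  · have h := hF ((σ.toLinearMap.comp e.toLinearMap).comp N.mkQ)
    change Fintype.linearCombination R (fun i => σ (e (N.mkQ (Pi.single i 1)))) = _ at h
    rw [← Fintype.range_linearCombination, h]
    constructor
    · rw [LinearMap.range_eq_top]
      exact (σ.surjective.comp e.surjective).comp N.mkQ_surjective
    · ext x
      simp
  · intro σ τ h
    have h1 : (σ.toLinearMap.comp e.toLinearMap).comp N.mkQ =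
        (τ.toLinearMap.comp e.toLinearMap).comp N.mkQ := by
      rw [← hF ((σ.toLinearMap.comp e.toLinearMap).comp N.mkQ),
        ← hF ((τ.toLinearMap.comp e.toLinearMap).comp N.mkQ)]
      exact congrArg (Fintype.linearCombination R) (congrArg Subtype.val h)
    ext y
    obtain ⟨x, rfl⟩ := (e.surjective.comp N.mkQ_surjective) y
    exact LinearMap.congr_fun h1 x
  · rintro ⟨g, hg, rfl⟩
    rw [← Fintype.range_linearCombination, LinearMap.range_eq_top] at hg
    refine ⟨e.symm.trans (LinearMap.quotKerEquivOfSurjective _ hg), Subtype.ext ?_⟩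
    funext i
    simp [LinearMap.quotKerEquivOfSurjective]

theorem tendsto_prod_one_sub_inv_pow {p : ℕ} (hp : 1 < p) (u : ℕ) :
    Tendsto (fun n => ∏ i ∈ Finset.range n, (1 - ((p : ℝ) ^ (i + 1 + u))⁻¹)) atTop
      (nhds (∏' i : ℕ, (1 - ((p : ℝ) ^ (i + 1 + u))⁻¹))) := by
  refine (Multipliable.hasProd ?_).tendsto_prod_nat
  simp_rw [sub_eq_add_neg]
  refine Real.multipliable_one_add_of_summable (Summable.neg ?_)
  have hp' : (1 : ℝ) < p := by exact_mod_cast hp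
  have h := (summable_geometric_of_lt_one (by positivity) (inv_lt_one_of_one_lt₀ hp')).mul_right
    ((p : ℝ)⁻¹ ^ (1 + u))
  refine h.congr fun i => ?_
  rw [← pow_add, inv_pow, add_assoc]

section PadicMatrixHaar

variable (p : ℕ) [Fact p.Prime] (m n : ℕ)

instance : SecondCountableTopology (Matrix (Fin m) (Fin n) ℤ_[p]) :=
  inferInstanceAs (SecondCountableTopology (Fin m → Fin n → ℤ_[p]))

instance : (padicMatrixHaar p m n).IsAddHaarMeasure := by
  unfold padicMatrixHaar; infer_instance

instance : IsProbabilityMeasure (padicMatrixHaar p m n) :=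
  ⟨Measure.addHaarMeasure_self⟩

theorem padicMatrixHaar_unique (ν : Measure (Matrix (Fin m) (Fin n) ℤ_[p])) [IsFiniteMeasure ν]
    [ν.IsAddLeftInvariant] : ν = ν Set.univ • padicMatrixHaar p m n :=
  Measure.addHaarMeasure_unique ν ⟨⟨Set.univ, isCompact_univ⟩, by
    rw [interior_univ]; exact Set.univ_nonempty⟩

end PadicMatrixHaar

theorem Submodule.isClosed_of_padicInt {p : ℕ} [Fact p.Prime] {n : ℕ}
    (N : Submodule ℤ_[p] (Fin n → ℤ_[p])) : IsClosed (N : Set (Fin n → ℤ_[p])) := by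
  obtain ⟨k, v, rfl⟩ := Submodule.fg_iff_exists_fin_generating_family.1
    (IsNoetherian.noetherian N)
  rw [← Fintype.range_linearCombination, LinearMap.coe_range]
  exact (isCompact_range (LinearMap.continuous_on_pi _)).isClosed

theorem PadicInt.isClosed_toZMod_preimage_singleton {p : ℕ} [Fact p.Prime] (c : ZMod p) :
    IsClosed ((PadicInt.toZMod : ℤ_[p] →+* ZMod p) ⁻¹' {c}) := by
  obtain ⟨x, rfl⟩ := ZMod.ringHom_surjective (PadicInt.toZMod (p := p)) c
  have h : (PadicInt.toZMod : ℤ_[p] →+* ZMod p) ⁻¹' {PadicInt.toZMod x} = Metric.ball x 1 := by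
    ext y
    rw [Metric.mem_ball, dist_eq_norm, ← PadicInt.mem_nonunits, ← IsLocalRing.mem_maximalIdeal,
      ← PadicInt.ker_toZMod, RingHom.mem_ker, map_sub, sub_eq_zero]
    rfl
  rw [h]
  exact IsUltrametricDist.isClosed_ball x 1

theorem span_row_eq_top_iff {R : Type*} [CommRing R] {m n : ℕ} (M : Matrix (Fin m) (Fin n) R) :
    Submodule.span R (Set.range M.row) = ⊤ ↔ Function.Surjective (fun v => v ᵥ* M) := by
  rw [← range_vecMulLinear, LinearMap.range_eq_top]
  rfl

theorem span_row_eq_top_iff_map_toZMod {p : ℕ} [Fact p.Prime] {m n : ℕ}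
    (M : Matrix (Fin m) (Fin n) ℤ_[p]) :
    Submodule.span ℤ_[p] (Set.range M.row) = ⊤ ↔
      Submodule.span (ZMod p) (Set.range (M.map PadicInt.toZMod).row) = ⊤ := by
  have hs := ZMod.ringHom_surjective (PadicInt.toZMod (p := p))
  have hmap : ∀ v : Fin m → ℤ_[p], (PadicInt.toZMod ∘ v) ᵥ* M.map PadicInt.toZMod =
      PadicInt.toZMod ∘ (v ᵥ* M) := fun v => by
    funext j
    exact (RingHom.map_vecMul PadicInt.toZMod M v j).symm
  constructor
  · rw [span_row_eq_top_iff, span_row_eq_top_iff]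
    intro h y
    choose x hx using fun j => hs (y j)
    obtain ⟨v, hv⟩ := h x
    refine ⟨PadicInt.toZMod ∘ v, ?_⟩
    beta_reduce at hv ⊢
    rw [hmap, hv]
    exact funext hx
  · rw [span_row_eq_top_iff]
    intro h
    refine top_le_iff.1 (Submodule.le_of_le_smul_of_le_jacobson_bot
      (I := IsLocalRing.maximalIdeal ℤ_[p]) Module.Finite.fg_top
      (IsLocalRing.maximalIdeal_le_jacobson _) fun x _ => ?_)
    obtain ⟨w, hw⟩ := h (PadicInt.toZMod ∘ x)
    choose v hv using fun i => hs (w i)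
    have hv' : PadicInt.toZMod ∘ v = w := funext hv
    rw [← sub_add_cancel x (v ᵥ* M), add_comm]
    refine Submodule.add_mem_sup ?_ ?_
    · rw [← range_vecMulLinear]
      exact ⟨v, rfl⟩
    · rw [pi_eq_sum_univ' (x - v ᵥ* M)]
      refine Submodule.sum_mem _ fun j _ => Submodule.smul_mem_smul ?_ trivial
      rw [← PadicInt.ker_toZMod, RingHom.mem_ker, Pi.sub_apply, map_sub, sub_eq_zero]
      beta_reduce at hw
      rw [← hv', hmap] at hw
      exact (congrFun hw j).symm

theorem span_row_eq_top_iff_linearIndependent_col {K : Type*} [Field K] {m n : ℕ}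
    (M : Matrix (Fin m) (Fin n) K) :
    Submodule.span K (Set.range M.row) = ⊤ ↔ LinearIndependent K M.col := by
  rw [span_row_eq_top_iff, Matrix.vecMul_surjective_iff_exists_left_inverse,
    ← Matrix.mulVec_injective_iff]
  constructor
  · rintro ⟨B, hB⟩ x y hxy
    have := congrArg (B *ᵥ ·) hxy
    simpa [Matrix.mulVec_mulVec, hB] using this
  · intro h
    obtain ⟨g, hg⟩ := M.mulVecLin.exists_leftInverse_of_injective (LinearMap.ker_eq_bot.2 h)
    refine ⟨LinearMap.toMatrix' g, ?_⟩
    have := congrArg LinearMap.toMatrix' hg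
    rwa [LinearMap.toMatrix'_comp, LinearMap.toMatrix'_id, ← Matrix.toLin'_apply',
      LinearMap.toMatrix'_toLin'] at this

theorem measurableSet_mapMatrix_toZMod_fiber {p : ℕ} [Fact p.Prime] {m n : ℕ}
    (b : Matrix (Fin m) (Fin n) (ZMod p)) :
    MeasurableSet ((AddMonoidHom.mapMatrix (PadicInt.toZMod (p := p)).toAddMonoidHom) ⁻¹' {b}) := by
  have h : (AddMonoidHom.mapMatrix (PadicInt.toZMod (p := p)).toAddMonoidHom) ⁻¹' {b} =
      ⋂ (i : Fin m) (j : Fin n), (fun M : Matrix (Fin m) (Fin n) ℤ_[p] => M i j) ⁻¹'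
        ((PadicInt.toZMod : ℤ_[p] →+* ZMod p) ⁻¹' {b i j}) := by
    ext M
    simp only [Set.mem_preimage, Set.mem_singleton_iff, Set.mem_iInter, ← Matrix.ext_iff]
    rfl
  rw [h]
  refine (isClosed_iInter fun i => isClosed_iInter fun j => ?_).measurableSet
  exact (PadicInt.isClosed_toZMod_preimage_singleton _).preimage (by fun_prop)

theorem setOf_span_row_eq_top {p : ℕ} [Fact p.Prime] {m n : ℕ} :
    {M : Matrix (Fin m) (Fin n) ℤ_[p] | Submodule.span ℤ_[p] (Set.range M.row) = ⊤} =
      (AddMonoidHom.mapMatrix (PadicInt.toZMod (p := p)).toAddMonoidHom) ⁻¹'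
        {b | LinearIndependent (ZMod p) b.col} := by
  ext M
  rw [Set.mem_ofPred_eq, span_row_eq_top_iff_map_toZMod, span_row_eq_top_iff_linearIndependent_col]
  rfl

theorem measurableSet_span_row_eq_top {p : ℕ} [Fact p.Prime] {m n : ℕ} :
    MeasurableSet {M : Matrix (Fin m) (Fin n) ℤ_[p] |
      Submodule.span ℤ_[p] (Set.range M.row) = ⊤} := by
  rw [setOf_span_row_eq_top, ← Set.biUnion_preimage_singleton]
  exact (Set.toFinite _).measurableSet_biUnion fun b _ => measurableSet_mapMatrix_toZMod_fiber b

theorem padicMatrixHaar_real_span_row_eq_top {p : ℕ} [Fact p.Prime] (n u : ℕ) :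
    (padicMatrixHaar p (n + u) n).real {M | Submodule.span ℤ_[p] (Set.range M.row) = ⊤} =
      ∏ i ∈ Finset.range n, (1 - ((p : ℝ) ^ (i + 1 + u))⁻¹) := by
  have hs := ZMod.ringHom_surjective (PadicInt.toZMod (p := p))
  rw [setOf_span_row_eq_top, measureReal_preimage_of_surjective _ _ ?_
    measurableSet_mapMatrix_toZMod_fiber]
  · have hcard : Nat.card {b : Matrix (Fin (n + u)) (Fin n) (ZMod p) //
        LinearIndependent (ZMod p) b.col} = ∏ i : Fin n, (p ^ (n + u) - p ^ (i : ℕ)) := by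
      have h := card_linearIndependent (K := ZMod p) (V := Fin (n + u) → ZMod p) (k := n)
        (by simp)
      rw [Module.finrank_fin_fun, ZMod.card] at h
      rw [← h]
      exact Nat.card_congr ((Matrix.transposeAddEquiv _ _ (ZMod p)).toEquiv.subtypeEquiv
        fun b => Iff.rfl)
    have hcard' : Nat.card (Matrix (Fin (n + u)) (Fin n) (ZMod p)) = ∏ _i : Fin n, p ^ (n + u) := by
      simp only [Matrix, Nat.card_fun, Nat.card_fin, Nat.card_zmod, Finset.prod_const,
        Finset.card_univ, Fintype.card_fin]
      rw [← pow_mul, ← pow_mul, mul_comm]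
    have hp : (p : ℝ) ≠ 0 := Nat.cast_ne_zero.2 (Fact.out : p.Prime).ne_zero
    change ((Nat.card {b : Matrix (Fin (n + u)) (Fin n) (ZMod p) //
        LinearIndependent (ZMod p) b.col} : ℕ) : ℝ) / _ = _
    rw [hcard, hcard', Nat.cast_prod, Nat.cast_prod, ← Finset.prod_div_distrib,
      Fin.prod_univ_eq_prod_range
        (fun i => ((p ^ (n + u) - p ^ i : ℕ) : ℝ) / ((p ^ (n + u) : ℕ) : ℝ)) n,
      ← Finset.prod_range_reflect]
    refine Finset.prod_congr rfl fun i hi => ?_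
    have hi' := Finset.mem_range.1 hi
    rw [Nat.cast_sub (Nat.pow_le_pow_right (Fact.out : p.Prime).pos (by omega)), Nat.cast_pow,
      Nat.cast_pow, sub_div, div_self (pow_ne_zero _ hp)]
    have h1 : n + u = (n - 1 - i) + (i + 1 + u) := by omega
    congr 1
    rw [h1]
    rw [pow_add, div_mul_eq_div_div, div_self (pow_ne_zero _ hp), one_div]
  · intro b
    choose x hx using fun i j => hs (b i j)
    exact ⟨Matrix.of x, Matrix.ext hx⟩

theorem LinearMap.isClosed_preimage_singleton_of_padicInt {p : ℕ} [Fact p.Prime] {n : ℕ}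
    {G : Type*} [AddCommGroup G] [Module ℤ_[p] G] (F : (Fin n → ℤ_[p]) →ₗ[ℤ_[p]] G) (c : G) :
    IsClosed (F ⁻¹' {c}) := by
  by_cases hc : ∃ x, F x = c
  · obtain ⟨x, rfl⟩ := hc
    have h : F ⁻¹' {F x} = (fun y => y - x) ⁻¹' (LinearMap.ker F : Set (Fin n → ℤ_[p])) := by
      ext y
      simp [sub_eq_zero]
    rw [h]
    exact (LinearMap.ker F).isClosed_of_padicInt.preimage (by fun_prop)
  · have h : F ⁻¹' {c} = ∅ := Set.eq_empty_of_forall_notMem fun x hx => hc ⟨x, hx⟩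
    rw [h]
    exact isClosed_empty

/-- The probability that all rows of a random matrix lie in a given submodule of finite index. -/
theorem padicMatrixHaar_real_row_mem_ker {p : ℕ} [Fact p.Prime] {m n : ℕ} {G : Type*}
    [AddCommGroup G] [Module ℤ_[p] G] [Finite G] (F : (Fin n → ℤ_[p]) →ₗ[ℤ_[p]] G)
    (hF : Function.Surjective F) :
    (padicMatrixHaar p m n).real {M | ∀ i, M.row i ∈ LinearMap.ker F} =
      ((Nat.card G : ℝ) ^ m)⁻¹ := by
  let π : Matrix (Fin m) (Fin n) ℤ_[p] →+ (Fin m → G) :=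
    { toFun := fun M i => F (M.row i)
      map_zero' := by funext i; exact map_zero F
      map_add' := fun M M' => by funext i; exact map_add F _ _ }
  have h : {M : Matrix (Fin m) (Fin n) ℤ_[p] | ∀ i, M.row i ∈ LinearMap.ker F} = π ⁻¹' {0} := by
    ext M
    exact funext_iff.symm
  rw [h, measureReal_preimage_of_surjective _ π]
  · simp [Nat.card_fun]
  · intro b
    choose x hx using fun i => hF (b i)
    exact ⟨Matrix.of x, funext hx⟩
  · intro b
    have h1 : π ⁻¹' {b} = ⋂ i, (fun M : Matrix (Fin m) (Fin n) ℤ_[p] => M.row i) ⁻¹'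
        (F ⁻¹' {b i}) := by
      ext M
      simp only [Set.mem_preimage, Set.mem_singleton_iff, Set.mem_iInter, funext_iff]
      rfl
    rw [h1]
    refine (isClosed_iInter fun i => ?_).measurableSet
    exact (F.isClosed_preimage_singleton_of_padicInt _).preimage (continuous_apply i)

theorem exists_injective_range_eq_ker {R G : Type*} [CommRing R] [IsDomain R]
    [IsPrincipalIdealRing R] [CharZero R] {n : ℕ} [AddCommGroup G] [Module R G] [Finite G]
    (F : (Fin n → R) →ₗ[R] G) (hF : Function.Surjective F) :
    ∃ φ : (Fin n → R) →ₗ[R] (Fin n → R), Function.Injective φ ∧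
      LinearMap.range φ = LinearMap.ker F := by
  have h1 := Submodule.finrank_quotient_add_finrank (LinearMap.ker F)
  rw [(F.quotKerEquivOfSurjective hF).finrank_eq,
    Module.IsTorsion.finrank_eq_zero (M := G) .of_finite, zero_add] at h1
  let e := LinearEquiv.ofFinrankEq (Fin n → R) (LinearMap.ker F) h1.symm
  refine ⟨(LinearMap.ker F).subtype.comp e.toLinearMap,
    (LinearMap.ker F).injective_subtype.comp e.injective, ?_⟩
  rw [LinearMap.range_comp, LinearEquiv.range, Submodule.map_top, Submodule.range_subtype]

theorem padicMatrixHaar_span_row_eq_ker {p : ℕ} [Fact p.Prime] {m n : ℕ} {G : Type*}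
    [AddCommGroup G] [Module ℤ_[p] G] [Finite G] (F : (Fin n → ℤ_[p]) →ₗ[ℤ_[p]] G)
    (hF : Function.Surjective F) :
    MeasurableSet {M : Matrix (Fin m) (Fin n) ℤ_[p] |
      Submodule.span ℤ_[p] (Set.range M.row) = LinearMap.ker F} ∧
    (padicMatrixHaar p m n).real {M | Submodule.span ℤ_[p] (Set.range M.row) = LinearMap.ker F} =
      ((Nat.card G : ℝ) ^ m)⁻¹ *
      (padicMatrixHaar p m n).real {M | Submodule.span ℤ_[p] (Set.range M.row) = ⊤} := by
  obtain ⟨φ, hφ, hr⟩ := exists_injective_range_eq_ker F hF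
  let Φ : Matrix (Fin m) (Fin n) ℤ_[p] →+ Matrix (Fin m) (Fin n) ℤ_[p] :=
    { toFun := fun M => Matrix.of fun i => φ (M.row i)
      map_zero' := by funext i; exact map_zero φ
      map_add' := fun M M' => by funext i; exact map_add φ _ _ }
  have hrow : ∀ M i, (Φ M).row i = φ (M.row i) := fun _ _ => rfl
  have hcont : Continuous Φ := by
    refine continuous_pi fun i => ?_
    exact (LinearMap.continuous_on_pi φ).comp (continuous_apply i)
  have hinj : Function.Injective Φ := fun M M' h => by
    funext i
    exact hφ (congrFun h i)
  have hemb : MeasurableEmbedding Φ := (hcont.isClosedEmbedding hinj).measurableEmbedding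
  have hrange : Set.range Φ = {M | ∀ i, M.row i ∈ LinearMap.ker F} := by
    ext M
    constructor
    · rintro ⟨M', rfl⟩ i
      rw [← hr, hrow]
      exact ⟨_, rfl⟩
    · intro h
      rw [← hr] at h
      choose x hx using h
      exact ⟨Matrix.of x, funext hx⟩
  have hspan : ∀ M, Submodule.span ℤ_[p] (Set.range (Φ M).row) =
      (Submodule.span ℤ_[p] (Set.range M.row)).map φ := fun M => by
    rw [Submodule.map_span, ← Set.range_comp]
    rfl
  have himage : Φ '' {M | Submodule.span ℤ_[p] (Set.range M.row) = ⊤} =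
      {M | Submodule.span ℤ_[p] (Set.range M.row) = LinearMap.ker F} := by
    ext M
    constructor
    · rintro ⟨M', hM', rfl⟩
      rw [Set.mem_ofPred_eq] at hM' ⊢
      rw [hspan, hM', Submodule.map_top, hr]
    · intro hM
      rw [Set.mem_ofPred_eq] at hM
      have h1 : M ∈ Set.range Φ := by
        rw [hrange]
        intro i
        rw [← hM]
        exact Submodule.subset_span ⟨i, rfl⟩
      obtain ⟨M', rfl⟩ := h1
      refine ⟨M', ?_, rfl⟩
      rw [hspan, ← hr, ← Submodule.map_top] at hM
      exact Submodule.map_injective_of_injective hφ hM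
  refine ⟨himage ▸ hemb.measurableSet_image.2 measurableSet_span_row_eq_top, ?_⟩
  let ν := (padicMatrixHaar p m n).comap Φ
  have hν : ∀ S, ν S = padicMatrixHaar p m n (Φ '' S) := hemb.comap_apply _
  have : IsFiniteMeasure ν := ⟨by rw [hν]; exact measure_lt_top _ _⟩
  have : ν.IsAddLeftInvariant := by
    rw [← forall_measure_preimage_add_iff]
    intro a S _
    rw [hν, hν, ← measure_preimage_add _ (Φ a) (Φ '' S)]
    congr 1
    ext M
    constructor
    · rintro ⟨M', hM', rfl⟩
      exact ⟨a + M', hM', map_add Φ _ _⟩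
    · rintro ⟨M', hM', h⟩
      refine ⟨-a + M', ?_, ?_⟩
      · rwa [Set.mem_preimage, add_neg_cancel_left]
      · rw [map_add, map_neg, h, neg_add_cancel_left]
  have hu := padicMatrixHaar_unique p m n ν
  rw [hν, Set.image_univ, hrange] at hu
  rw [← himage, measureReal_def, ← hν, hu, Measure.smul_apply, smul_eq_mul, ENNReal.toReal_mul,
    ← padicMatrixHaar_real_row_mem_ker F hF]
  rfl

theorem padicMatrixHaar_real_quotient_span_row {p : ℕ} [Fact p.Prime] (n u : ℕ) {G : Type*}
    [AddCommGroup G] [Module ℤ_[p] G] [Finite G] :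
    (Nat.card (G ≃ₗ[ℤ_[p]] G) : ℝ) * (padicMatrixHaar p (n + u) n).real
      {M | Nonempty (((Fin n → ℤ_[p]) ⧸ Submodule.span ℤ_[p] (Set.range M.row)) ≃ₗ[ℤ_[p]] G)} =
    (Nat.card {g : Fin n → G // Submodule.span ℤ_[p] (Set.range g) = ⊤} : ℝ) *
      (((Nat.card G : ℝ) ^ (n + u))⁻¹ *
        ∏ i ∈ Finset.range n, (1 - ((p : ℝ) ^ (i + 1 + u))⁻¹)) := by
  classical
  let S := {g : Fin n → G // Submodule.span ℤ_[p] (Set.range g) = ⊤}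
  have : Fintype S := Fintype.ofFinite S
  let F : S → (Fin n → ℤ_[p]) →ₗ[ℤ_[p]] G := fun g => Fintype.linearCombination ℤ_[p] g.1
  have hF : ∀ g, Function.Surjective (F g) := fun g => by
    rw [← LinearMap.range_eq_top, Fintype.range_linearCombination]
    exact g.2
  let E : S → Set (Matrix (Fin (n + u)) (Fin n) ℤ_[p]) := fun g =>
    {M | Submodule.span ℤ_[p] (Set.range M.row) = LinearMap.ker (F g)}
  set T : Set (Matrix (Fin (n + u)) (Fin n) ℤ_[p]) :=
    {M | Nonempty (((Fin n → ℤ_[p]) ⧸ Submodule.span ℤ_[p] (Set.range M.row)) ≃ₗ[ℤ_[p]] G)}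
  have hE : ∀ g, MeasurableSet (E g) := fun g => (padicMatrixHaar_span_row_eq_ker (F g) (hF g)).1
  have hTE : T = ⋃ g, E g := by
    ext M
    rw [Set.mem_iUnion]
    constructor
    · rintro ⟨e⟩
      have h1 := card_surjections_with_kernel _ e
      have : Finite (G ≃ₗ[ℤ_[p]] G) := Finite.of_injective _ DFunLike.coe_injective
      have h2 : 0 < Nat.card (G ≃ₗ[ℤ_[p]] G) := Nat.card_pos
      rw [← h1] at h2
      obtain ⟨⟨g, hg, hk⟩⟩ := (Nat.card_pos_iff.1 h2).1
      exact ⟨⟨g, hg⟩, hk⟩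
    · rintro ⟨g, hg⟩
      exact ⟨(Submodule.quotEquivOfEq _ _ hg).trans ((F g).quotKerEquivOfSurjective (hF g))⟩
  have hT : MeasurableSet T := by
    rw [hTE]
    exact MeasurableSet.iUnion hE
  have hpoint : ∀ M, ∑ g, (E g).indicator (fun _ => (1 : ℝ)) M =
      T.indicator (fun _ => (Nat.card (G ≃ₗ[ℤ_[p]] G) : ℝ)) M := by
    intro M
    by_cases hM : M ∈ T
    · rw [Set.indicator_of_mem hM]
      obtain ⟨e⟩ := hM
      rw [← card_surjections_with_kernel _ e]
      simp only [Set.indicator_apply]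
      rw [Finset.sum_boole, ← Fintype.card_subtype, ← Nat.card_eq_fintype_card]
      congr 1
      exact Nat.card_congr (Equiv.subtypeSubtypeEquivSubtypeInter
        (fun g : Fin n → G => Submodule.span ℤ_[p] (Set.range g) = ⊤)
        (fun g => Submodule.span ℤ_[p] (Set.range M.row) =
          LinearMap.ker (Fintype.linearCombination ℤ_[p] g)))
    · rw [Set.indicator_of_notMem hM]
      refine Finset.sum_eq_zero fun g _ => Set.indicator_of_notMem (fun hg => hM ?_) _
      rw [hTE]
      exact Set.mem_iUnion.2 ⟨g, hg⟩
  have h_integral := congrArg (fun f => ∫ M, f M ∂(padicMatrixHaar p (n + u) n)) (funext hpoint)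
  beta_reduce at h_integral
  rw [integral_finsetSum _ fun g _ => (integrable_const _).indicator (hE g),
    integral_indicator_const _ hT] at h_integral
  simp_rw [integral_indicator_const _ (hE _)] at h_integral
  rw [smul_eq_mul, mul_comm] at h_integral
  rw [← h_integral, ← padicMatrixHaar_real_span_row_eq_top]
  simp_rw [smul_eq_mul, mul_one]
  rw [Finset.sum_congr rfl fun g _ => (padicMatrixHaar_span_row_eq_ker (F g) (hF g)).2,
    Finset.sum_const, nsmul_eq_mul, Finset.card_univ, ← Nat.card_eq_fintype_card]

theorem cokernel_distribution (p : ℕ) [Fact p.Prime] (u : ℕ)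
    (G : Type) [AddCommGroup G] [Module ℤ_[p] G] [Finite G]
    (hG : ∃ k : ℕ, Nat.card G = p ^ k) :
    Tendsto
      (fun n : ℕ =>
        (padicMatrixHaar p (n + u) n
          {M : Matrix (Fin (n + u)) (Fin n) ℤ_[p] |
            Nonempty
              (((Fin (n + u) → ℤ_[p]) ⧸ LinearMap.range M.mulVecLin) ≃ₗ[ℤ_[p]]
                ((Fin u → ℤ_[p]) × G))}).toReal)
      atTop
      (nhds ((∏' i : ℕ, (1 - ((p : ℝ) ^ (i + 1 + u))⁻¹)) /
        ((Nat.card G : ℝ) ^ u * (Nat.card (G ≃+ G) : ℝ)))) := by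
  obtain ⟨k, hk⟩ := hG
  have hAut : Nat.card (G ≃+ G) = Nat.card (G ≃ₗ[ℤ_[p]] G) :=
    Nat.card_congr
      { toFun := fun f => f.toLinearEquiv (f.map_padicInt_smul hk)
        invFun := fun f => f.toAddEquiv
        left_inv := fun _ => rfl
        right_inv := fun _ => rfl }
  have : Finite (G ≃ₗ[ℤ_[p]] G) := Finite.of_injective _ DFunLike.coe_injective
  have hA : (Nat.card (G ≃ₗ[ℤ_[p]] G) : ℝ) ≠ 0 := Nat.cast_ne_zero.2 Nat.card_pos.ne'
  have hG0 : (Nat.card G : ℝ) ≠ 0 := Nat.cast_ne_zero.2 Nat.card_pos.ne'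
  rw [hAut]
  have hlim := ((tendsto_card_span_eq_top_div ℤ_[p] G).mul
    (tendsto_prod_one_sub_inv_pow (Fact.out : p.Prime).one_lt u)).div_const
      ((Nat.card G : ℝ) ^ u * (Nat.card (G ≃ₗ[ℤ_[p]] G) : ℝ))
  rw [one_mul] at hlim
  refine hlim.congr fun n => ?_
  have hset : {M : Matrix (Fin (n + u)) (Fin n) ℤ_[p] |
      Nonempty (((Fin (n + u) → ℤ_[p]) ⧸ LinearMap.range M.mulVecLin) ≃ₗ[ℤ_[p]]
        ((Fin u → ℤ_[p]) × G))} =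
      {M | Nonempty (((Fin n → ℤ_[p]) ⧸ Submodule.span ℤ_[p] (Set.range M.row)) ≃ₗ[ℤ_[p]] G)} := by
    ext M
    rw [Set.mem_ofPred_eq, Set.mem_ofPred_eq, M.nonempty_cokernel_equiv_iff G,
      Matrix.range_mulVecLin, Matrix.col_transpose]
  have h := padicMatrixHaar_real_quotient_span_row (p := p) n u (G := G)
  rw [hset, ← measureReal_def, div_eq_iff (mul_ne_zero (pow_ne_zero _ hG0) hA), mul_comm (_ ^ u),
    ← mul_assoc, mul_comm (Measure.real _ _), h, pow_add]
  field_simp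
end

section
/- Let p be a prime, u ≥ 0 an integer, and G a finite abelian p-group. For each n, let μ_n be the Haar probability measure on (n+u) × n matrices over ℤ_p. Then lim_{n→∞} E_{μ_n}[#Sur((coker M)[p^∞], G)] = |G|^{−u}, where (coker M)[p^∞] denotes the torsion submodule of coker M and the expectation is of the number of surjective ℤ_p-module homomorphisms from this torsion submodule onto G. -/
open MeasureTheory Filter

/-- The `p^∞`-torsion submodule of a `ℤ_p`-module: the elements annihilated by
some power of `p`. -/
def pPrimaryTorsion (p : ℕ) [Fact p.Prime] (M : Type*) [AddCommGroup M]
    [Module ℤ_[p] M] : Submodule ℤ_[p] M where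
  carrier := {x | ∃ k : ℕ, (p : ℤ_[p]) ^ k • x = 0}
  zero_mem' := ⟨0, smul_zero _⟩
  add_mem' := by
    rintro a b ⟨k, hk⟩ ⟨l, hl⟩
    refine ⟨k + l, ?_⟩
    have ha : (p : ℤ_[p]) ^ (k + l) • a = 0 := by
      rw [pow_add, mul_comm, mul_smul, hk, smul_zero]
    have hb : (p : ℤ_[p]) ^ (k + l) • b = 0 := by
      rw [pow_add, mul_smul, hl, smul_zero]
    rw [smul_add, ha, hb, add_zero]
  smul_mem' := by
    rintro c x ⟨k, hk⟩
    exact ⟨k, by rw [smul_comm, hk, smul_zero]⟩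

theorem exists_pow_smul_mem_of_ne_zero {p : ℕ} [Fact p.Prime] {M : Type*} [AddCommGroup M]
    [Module ℤ_[p] M] {N : Submodule ℤ_[p] M} {a : ℤ_[p]} (ha : a ≠ 0) {x : M} (hx : a • x ∈ N) :
    ∃ k : ℕ, (p : ℤ_[p]) ^ k • x ∈ N := by
  refine ⟨a.valuation, ?_⟩
  have h := PadicInt.unitCoeff_spec ha
  have h' : (p : ℤ_[p]) ^ a.valuation = ((PadicInt.unitCoeff ha)⁻¹ : ℤ_[p]ˣ) * a := by
    rw [Units.eq_inv_mul_iff_mul_eq]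
    exact h.symm
  rw [h', mul_smul]
  exact N.smul_mem _ hx

section SmithNormalForm

variable {R ι V : Type*} [CommRing R] [AddCommGroup V] [Module R V] {N : Submodule R V} {k : ℕ}

/-- The map from `R ^ k` to `V ⧸ N` sending the `i`-th coordinate vector to the class of the basis
vector of `V` matched with the `i`-th basis vector of `N`. -/
noncomputable def Module.Basis.SmithNormalForm.toQuotient
    (snf : Module.Basis.SmithNormalForm N ι k) :
    (Fin k → R) →ₗ[R] V ⧸ N :=
  N.mkQ ∘ₗ Fintype.linearCombination R (snf.bM ∘ snf.f)

theorem Module.Basis.SmithNormalForm.ker_toQuotient (snf : Module.Basis.SmithNormalForm N ι k) :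
    LinearMap.ker snf.toQuotient = Submodule.pi Set.univ fun i => Ideal.span {snf.a i} := by
  ext c
  simp only [toQuotient, LinearMap.mem_ker, LinearMap.comp_apply, Submodule.mkQ_apply,
    Submodule.Quotient.mk_eq_zero, Submodule.mem_pi, Set.mem_univ, true_imp_iff,
    Ideal.mem_span_singleton, Fintype.linearCombination_apply, Function.comp_apply]
  constructor
  · intro h i
    have h1 := snf.repr_apply_embedding_eq_repr_smul ⟨_, h⟩ (i := i)
    have h2 : snf.bM.repr (∑ i, c i • snf.bM (snf.f i)) (snf.f i) = c i := by
      classical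
      simp [map_sum, Finsupp.single_apply, snf.f.injective.eq_iff]
    rw [h2, map_smul] at h1
    exact ⟨_, by simpa using h1⟩
  · intro h
    refine N.sum_mem fun i _ => ?_
    obtain ⟨d, hd⟩ := h i
    rw [hd, mul_comm, mul_smul, ← snf.snf]
    exact N.smul_mem _ (Subtype.mem _)

end SmithNormalForm

theorem Module.Basis.SmithNormalForm.range_toQuotient {p : ℕ} [Fact p.Prime] {ι V : Type*}
    [Fintype ι] [AddCommGroup V] [Module ℤ_[p] V] {N : Submodule ℤ_[p] V} {k : ℕ}
    (snf : Module.Basis.SmithNormalForm N ι k) :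
    LinearMap.range snf.toQuotient = pPrimaryTorsion p (V ⧸ N) := by
  apply le_antisymm
  · rintro _ ⟨c, rfl⟩
    simp only [toQuotient, LinearMap.comp_apply, Fintype.linearCombination_apply, map_sum, map_smul]
    refine Submodule.sum_mem _ fun i _ => Submodule.smul_mem _ _ ?_
    have ha : snf.a i ≠ 0 := by
      intro h
      apply snf.bN.ne_zero i
      ext
      rw [snf.snf, h, zero_smul, Submodule.coe_zero]
    obtain ⟨j, hj⟩ := exists_pow_smul_mem_of_ne_zero (N := N) ha (x := snf.bM (snf.f i))
      (by rw [← snf.snf]; exact Subtype.mem _)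
    exact ⟨j, by
      rw [Function.comp_apply, ← map_smul, Submodule.mkQ_apply, Submodule.Quotient.mk_eq_zero]
      exact hj⟩
  · intro x hx
    obtain ⟨y, rfl⟩ := N.mkQ_surjective x
    obtain ⟨j, hj⟩ := hx
    rw [← map_smul, Submodule.mkQ_apply, Submodule.Quotient.mk_eq_zero] at hj
    have hp : (p : ℤ_[p]) ^ j ≠ 0 := pow_ne_zero _ PadicInt.prime_p.ne_zero
    have h0 : ∀ l ∉ Set.range snf.f, snf.bM.repr y l = 0 := by
      intro l hl
      have := snf.repr_eq_zero_of_notMem_range ⟨_, hj⟩ hl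
      simpa [hp] using this
    refine ⟨fun i => snf.bM.repr y (snf.f i), ?_⟩
    simp only [toQuotient, LinearMap.comp_apply, Fintype.linearCombination_apply,
      Function.comp_apply]
    congr 1
    conv_rhs => rw [← snf.bM.sum_repr y]
    refine Finset.sum_of_injOn snf.f snf.f.injective.injOn (fun _ _ => by simp) ?_ (fun _ _ => rfl)
    intro l _ hl
    rw [h0 l (by simpa using hl), zero_smul]

/-- The coordinates of a functional on `Rⁿ`, given as a row vector, with respect to the dual of
the basis `b`. -/
noncomputable def Module.Basis.dotProductEquivFun {R n κ : Type*} [CommRing R] [Fintype n]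
    [DecidableEq n] (b : Module.Basis κ R (n → R)) : (n → R) ≃ₗ[R] (κ → R) :=
  dotProductEquiv R n ≪≫ₗ (b.constr R).symm

theorem Module.Basis.dotProductEquivFun_apply {R n κ : Type*} [CommRing R] [Fintype n]
    [DecidableEq n] (b : Module.Basis κ R (n → R)) (y : n → R) (i : κ) :
    b.dotProductEquivFun y i = y ⬝ᵥ b i := by
  simp [dotProductEquivFun, Module.Basis.constr]

/-- For an injective matrix, the torsion of the cokernel is isomorphic to the cokernel of the
transpose. -/
theorem nonempty_pPrimaryTorsion_equiv_quotient_span_rows {p : ℕ} [Fact p.Prime] {m n : ℕ}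
    (M : Matrix (Fin m) (Fin n) ℤ_[p]) (hM : Function.Injective M.mulVecLin) :
    Nonempty (pPrimaryTorsion p ((Fin m → ℤ_[p]) ⧸ LinearMap.range M.mulVecLin) ≃ₗ[ℤ_[p]]
      (Fin n → ℤ_[p]) ⧸ Submodule.span ℤ_[p] (Set.range M.row)) := by
  obtain ⟨k, snf⟩ := Submodule.smithNormalForm (Pi.basisFun ℤ_[p] (Fin m))
    (LinearMap.range M.mulVecLin)
  let e := LinearEquiv.ofInjective M.mulVecLin hM
  let b := snf.bN.map e.symm
  have hb : ∀ i, M.mulVec (b i) = snf.a i • snf.bM (snf.f i) := by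
    intro i
    rw [← snf.snf]
    have : e (b i) = snf.bN i := by simp [b]
    rw [← this]
    rfl
  have hmap : (Submodule.span ℤ_[p] (Set.range M.row)).map
      (b.dotProductEquivFun : (Fin n → ℤ_[p]) →ₗ[ℤ_[p]] (Fin k → ℤ_[p])) =
      LinearMap.ker snf.toQuotient := by
    have key : ∀ z i, b.dotProductEquivFun (Matrix.vecMul z M) i =
        snf.a i * snf.bM.dotProductEquivFun z (snf.f i) := by
      intro z i
      rw [Module.Basis.dotProductEquivFun_apply, Module.Basis.dotProductEquivFun_apply,
        ← Matrix.dotProduct_mulVec, hb, dotProduct_smul, smul_eq_mul]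
    rw [snf.ker_toQuotient, ← range_vecMulLinear]
    ext c
    simp only [Submodule.mem_map, LinearMap.mem_range, Matrix.vecMulLinear_apply,
      exists_exists_eq_and, Submodule.mem_pi, Set.mem_univ, true_imp_iff,
      Ideal.mem_span_singleton, LinearEquiv.coe_coe]
    constructor
    · rintro ⟨z, rfl⟩ i
      exact ⟨_, key z i⟩
    · intro h
      choose d hd using h
      refine ⟨snf.bM.dotProductEquivFun.symm (Function.extend snf.f d 0), ?_⟩
      ext1 i
      rw [key, LinearEquiv.apply_symm_apply, snf.f.injective.extend_apply, hd]
  exact ⟨((LinearEquiv.ofEq _ _ snf.range_toQuotient).symm ≪≫ₗ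
    snf.toQuotient.quotKerEquivRange.symm) ≪≫ₗ
    (Submodule.Quotient.equiv _ _ b.dotProductEquivFun hmap).symm⟩

theorem card_surjective_pPrimaryTorsion {p : ℕ} [Fact p.Prime] {m n : ℕ}
    (G : Type*) [AddCommGroup G] [Module ℤ_[p] G]
    (M : Matrix (Fin m) (Fin n) ℤ_[p]) (hM : Function.Injective M.mulVecLin) :
    Nat.card {f : pPrimaryTorsion p ((Fin m → ℤ_[p]) ⧸ LinearMap.range M.mulVecLin) →ₗ[ℤ_[p]] G //
      Function.Surjective f} =
    Nat.card {F : {F : (Fin n → ℤ_[p]) →ₗ[ℤ_[p]] G // Function.Surjective F} //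
      ∀ i, F.1 (M i) = 0} := by
  obtain ⟨e⟩ := nonempty_pPrimaryTorsion_equiv_quotient_span_rows M hM
  refine Nat.card_congr (Equiv.ofBijective (fun f => ⟨⟨f.1 ∘ₗ e.symm.toLinearMap ∘ₗ
    Submodule.mkQ _, f.2.comp (e.symm.surjective.comp (Submodule.mkQ_surjective _))⟩,
    fun i => ?_⟩) ⟨?_, ?_⟩)
  · have h : (Submodule.span ℤ_[p] (Set.range M.row)).mkQ (M i) = 0 := by
      rw [Submodule.mkQ_apply, Submodule.Quotient.mk_eq_zero]
      exact Submodule.subset_span ⟨i, rfl⟩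
    simp only [LinearMap.comp_apply, h, map_zero]
  · intro f g hfg
    ext1
    have h : f.1 ∘ₗ e.symm.toLinearMap ∘ₗ Submodule.mkQ _ =
      g.1 ∘ₗ e.symm.toLinearMap ∘ₗ Submodule.mkQ _ := congrArg (fun F => F.1.1) hfg
    ext1 x
    obtain ⟨y, hy⟩ := Submodule.mkQ_surjective _ (e x)
    have hx : x = e.symm (Submodule.mkQ _ y) := by rw [hy, e.symm_apply_apply]
    rw [hx]
    exact LinearMap.congr_fun h y
  · rintro ⟨⟨F, hF⟩, h0⟩
    have hle : Submodule.span ℤ_[p] (Set.range M.row) ≤ LinearMap.ker F := by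
      rw [Submodule.span_le]
      rintro _ ⟨i, rfl⟩
      exact h0 i
    refine ⟨⟨Submodule.liftQ _ F hle ∘ₗ e.toLinearMap, ?_⟩, ?_⟩
    · refine Function.Surjective.comp (g := Submodule.liftQ _ F hle) ?_ e.surjective
      intro g
      obtain ⟨x, rfl⟩ := hF g
      exact ⟨Submodule.mkQ _ x, by simp⟩
    · ext x
      simp

open scoped Topology in
theorem continuous_smul_const_of_pow_smul_eq_zero {p : ℕ} [Fact p.Prime] {G : Type*}
    [AddCommGroup G] [Module ℤ_[p] G] [TopologicalSpace G] [DiscreteTopology G] {k : ℕ} {g : G}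
    (hg : (p : ℤ_[p]) ^ k • g = 0) : Continuous fun c : ℤ_[p] => c • g := by
  refine continuous_of_continuousAt_zero (LinearMap.toSpanSingleton ℤ_[p] G g).toAddMonoidHom ?_
  have hev : ∀ᶠ c : ℤ_[p] in 𝓝 0, c • g = 0 := by
    have hpos : (0 : ℝ) < (p : ℝ) ^ (-(k : ℤ)) :=
      zpow_pos (by exact_mod_cast (Fact.out : p.Prime).pos) _
    filter_upwards [Metric.ball_mem_nhds (0 : ℤ_[p]) hpos] with c hc
    rw [mem_ball_zero_iff] at hc
    have := (PadicInt.norm_le_pow_iff_mem_span_pow c k).1 hc.le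
    rw [Ideal.mem_span_singleton'] at this
    obtain ⟨d, rfl⟩ := this
    rw [mul_smul, hg, smul_zero]
  refine (continuousAt_const (y := (0 : G))).congr ?_
  filter_upwards [hev] with c hc
  exact hc.symm

theorem continuous_linearMap_of_pow_smul_eq_zero {p : ℕ} [Fact p.Prime] {G : Type*}
    [AddCommGroup G] [Module ℤ_[p] G] [TopologicalSpace G] [DiscreteTopology G] {k : ℕ}
    (hG : ∀ g : G, (p : ℤ_[p]) ^ k • g = 0) {n : ℕ} (F : (Fin n → ℤ_[p]) →ₗ[ℤ_[p]] G) :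
    Continuous F := by
  have h : (F : (Fin n → ℤ_[p]) → G) = fun x => ∑ i, x i • F (Pi.single i 1) := by
    ext x
    simp_rw [← map_smul, ← map_sum]
    congr 1
    exact pi_eq_sum_univ' x
  rw [h]
  exact continuous_finsetSum _ fun i _ =>
    (continuous_smul_const_of_pow_smul_eq_zero (hG _)).comp (continuous_apply i)

instance (p : ℕ) [Fact p.Prime] (m n : ℕ) :
    IsProbabilityMeasure (padicMatrixHaar p m n) :=
  ⟨Measure.addHaarMeasure_self⟩

instance (p : ℕ) [Fact p.Prime] (m n : ℕ) :
    (padicMatrixHaar p m n).IsAddLeftInvariant := by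
  unfold padicMatrixHaar
  infer_instance

theorem measurableSet_forall_apply_row_eq_zero {p : ℕ} [Fact p.Prime] {G : Type*}
    [AddCommGroup G] [Module ℤ_[p] G] {k : ℕ} (hG : ∀ g : G, (p : ℤ_[p]) ^ k • g = 0) {m n : ℕ}
    (F : (Fin n → ℤ_[p]) →ₗ[ℤ_[p]] G) :
    MeasurableSet {M : Matrix (Fin m) (Fin n) ℤ_[p] | ∀ i, F (M i) = 0} := by
  let : TopologicalSpace G := ⊥
  have : DiscreteTopology G := ⟨rfl⟩
  have hF := continuous_linearMap_of_pow_smul_eq_zero hG F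
  rw [Set.ofPred_forall]
  exact (isClosed_iInter fun i =>
    isClosed_eq (hF.comp (continuous_apply i)) continuous_const).measurableSet

theorem measureReal_forall_apply_row_eq_zero {p : ℕ} [Fact p.Prime] {G : Type*}
    [AddCommGroup G] [Module ℤ_[p] G] [Finite G] {k : ℕ} (hG : ∀ g : G, (p : ℤ_[p]) ^ k • g = 0)
    {m n : ℕ} (F : (Fin n → ℤ_[p]) →ₗ[ℤ_[p]] G) (hF : Function.Surjective F) :
    (padicMatrixHaar p m n).real {M | ∀ i, F (M i) = 0} = ((Nat.card G : ℝ)⁻¹) ^ m := by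
  let Φ : Matrix (Fin m) (Fin n) ℤ_[p] →+ (Fin m → G) :=
    { toFun := fun M i => F (M i)
      map_zero' := by ext i; exact map_zero F
      map_add' := fun A B => by ext i; exact map_add F (A i) (B i) }
  have hΦ : Function.Surjective Φ := by
    intro g
    choose r hr using hF
    exact ⟨fun i => r (g i), funext fun i => hr _⟩
  have hset : (Φ.ker : Set (Matrix (Fin m) (Fin n) ℤ_[p])) = {M | ∀ i, F (M i) = 0} := by
    ext M
    exact funext_iff
  have hidx : Φ.ker.index = Nat.card G ^ m := by
    rw [AddSubgroup.index_ker, AddMonoidHom.range_eq_top.2 hΦ]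
    simp [Nat.card_fun]
  have hpos : Nat.card G ^ m ≠ 0 := pow_ne_zero _ Nat.card_pos.ne'
  have : Φ.ker.FiniteIndex := ⟨by rwa [hidx]⟩
  have h := AddSubgroup.index_mul_measure Φ.ker
    (by rw [hset]; exact measurableSet_forall_apply_row_eq_zero hG F) (padicMatrixHaar p m n)
  rw [hset, hidx, measure_univ] at h
  have h' := congrArg ENNReal.toReal h
  rw [ENNReal.toReal_mul, ENNReal.toReal_natCast, ENNReal.toReal_one] at h'
  rw [inv_pow, Measure.real]
  push_cast at h'
  exact eq_inv_of_mul_eq_one_right h'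

section Expectation

variable {p : ℕ} [Fact p.Prime] {G : Type*} [AddCommGroup G] [Module ℤ_[p] G]

theorem card_linearMap_fin (n : ℕ) :
    Nat.card ((Fin n → ℤ_[p]) →ₗ[ℤ_[p]] G) = Nat.card G ^ n := by
  rw [← Nat.card_congr ((Pi.basisFun ℤ_[p] (Fin n)).constr ℤ_[p] (M' := G)).toEquiv]
  simp [Nat.card_fun]

theorem card_surjective_vanishing_eq_sum_indicator {m n : ℕ}
    [Fintype {F : (Fin n → ℤ_[p]) →ₗ[ℤ_[p]] G // Function.Surjective F}]
    (M : Matrix (Fin m) (Fin n) ℤ_[p]) :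
    (Nat.card {F : {F : (Fin n → ℤ_[p]) →ₗ[ℤ_[p]] G // Function.Surjective F} //
      ∀ i, F.1 (M i) = 0} : ℝ) =
    ∑ F : {F : (Fin n → ℤ_[p]) →ₗ[ℤ_[p]] G // Function.Surjective F},
      Set.indicator {M : Matrix (Fin m) (Fin n) ℤ_[p] | ∀ i, F.1 (M i) = 0}
        (fun _ => (1 : ℝ)) M := by
  classical
  simp [Nat.card_eq_fintype_card, Fintype.card_subtype, Set.indicator_apply]

variable [Finite G]

instance (n : ℕ) : Finite ((Fin n → ℤ_[p]) →ₗ[ℤ_[p]] G) :=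
  Finite.of_equiv (Fin n → G) ((Pi.basisFun ℤ_[p] (Fin n)).constr ℤ_[p]).toEquiv

theorem integrable_card_surjective_vanishing {k : ℕ} (hG : ∀ g : G, (p : ℤ_[p]) ^ k • g = 0)
    (m n : ℕ) :
    Integrable (fun M : Matrix (Fin m) (Fin n) ℤ_[p] =>
      (Nat.card {F : {F : (Fin n → ℤ_[p]) →ₗ[ℤ_[p]] G // Function.Surjective F} //
        ∀ i, F.1 (M i) = 0} : ℝ)) (padicMatrixHaar p m n) := by
  have := Fintype.ofFinite {F : (Fin n → ℤ_[p]) →ₗ[ℤ_[p]] G // Function.Surjective F}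
  simp_rw [card_surjective_vanishing_eq_sum_indicator]
  exact integrable_finsetSum _ fun F _ =>
    (integrable_const 1).indicator (measurableSet_forall_apply_row_eq_zero hG F.1)

theorem integral_card_surjective_vanishing {k : ℕ} (hG : ∀ g : G, (p : ℤ_[p]) ^ k • g = 0)
    (m n : ℕ) :
    ∫ M : Matrix (Fin m) (Fin n) ℤ_[p],
      (Nat.card {F : {F : (Fin n → ℤ_[p]) →ₗ[ℤ_[p]] G // Function.Surjective F} //
        ∀ i, F.1 (M i) = 0} : ℝ) ∂(padicMatrixHaar p m n) =
    Nat.card {F : (Fin n → ℤ_[p]) →ₗ[ℤ_[p]] G // Function.Surjective F} *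
      ((Nat.card G : ℝ)⁻¹) ^ m := by
  have := Fintype.ofFinite {F : (Fin n → ℤ_[p]) →ₗ[ℤ_[p]] G // Function.Surjective F}
  simp_rw [card_surjective_vanishing_eq_sum_indicator]
  rw [integral_finsetSum _ fun F _ =>
    (integrable_const 1).indicator (measurableSet_forall_apply_row_eq_zero hG F.1)]
  have h : ∀ F : {F : (Fin n → ℤ_[p]) →ₗ[ℤ_[p]] G // Function.Surjective F},
      ∫ M, Set.indicator {M : Matrix (Fin m) (Fin n) ℤ_[p] | ∀ i, F.1 (M i) = 0}
        (fun _ => (1 : ℝ)) M ∂(padicMatrixHaar p m n) = ((Nat.card G : ℝ)⁻¹) ^ m := by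
    intro F
    rw [integral_indicator_const _ (measurableSet_forall_apply_row_eq_zero hG F.1),
      measureReal_forall_apply_row_eq_zero hG F.1 F.2, smul_eq_mul, mul_one]
  simp [h, Nat.card_eq_fintype_card]

/-- Non-surjective maps take values in a proper submodule. -/
theorem card_pow_le_card_surjective_add (n : ℕ) [Fintype {H : Submodule ℤ_[p] G // H ≠ ⊤}] :
    Nat.card G ^ n ≤ Nat.card {F : (Fin n → ℤ_[p]) →ₗ[ℤ_[p]] G // Function.Surjective F} +
      ∑ H : {H : Submodule ℤ_[p] G // H ≠ ⊤}, Nat.card H.1 ^ n := by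
  classical
  rw [← card_linearMap_fin (p := p), ← Finset.sum_congr rfl fun H _ => card_linearMap_fin (p := p)
    (G := H.1) n, ← Nat.card_sigma, ← Nat.card_sum]
  refine Nat.card_le_card_of_surjective (Sum.elim (fun F => F.1) fun x => x.1.1.subtype ∘ₗ x.2) ?_
  intro F
  by_cases hF : Function.Surjective F
  · exact ⟨.inl ⟨F, hF⟩, rfl⟩
  · exact ⟨.inr ⟨⟨LinearMap.range F, by rwa [Ne, LinearMap.range_eq_top]⟩, F.rangeRestrict⟩, rfl⟩

open scoped Topology in
theorem tendsto_card_surjective_div (p : ℕ) [Fact p.Prime] (G : Type*) [AddCommGroup G]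
    [Module ℤ_[p] G] [Finite G] :
    Tendsto (fun n : ℕ => (Nat.card {F : (Fin n → ℤ_[p]) →ₗ[ℤ_[p]] G // Function.Surjective F} : ℝ)
      * ((Nat.card G : ℝ)⁻¹) ^ n) atTop (𝓝 1) := by
  have : Fintype {H : Submodule ℤ_[p] G // H ≠ ⊤} := Fintype.ofFinite _
  have hpos : (0 : ℝ) < Nat.card G := by exact_mod_cast Nat.card_pos
  have hlim : Tendsto (fun n : ℕ => (1 : ℝ) - ∑ H : {H : Submodule ℤ_[p] G // H ≠ ⊤},
      ((Nat.card H.1 : ℝ) / Nat.card G) ^ n) atTop (𝓝 1) := by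
    have h : Tendsto (fun n : ℕ => ∑ H : {H : Submodule ℤ_[p] G // H ≠ ⊤},
        ((Nat.card H.1 : ℝ) / Nat.card G) ^ n) atTop
        (𝓝 (∑ _H : {H : Submodule ℤ_[p] G // H ≠ ⊤}, (0 : ℝ))) := by
      refine tendsto_finsetSum _ fun H _ => tendsto_pow_atTop_nhds_zero_of_lt_one (by positivity) ?_
      rw [div_lt_one hpos]
      have hlt : (H.1 : Set G) ⊂ Set.univ := by
        rw [Set.ssubset_univ_iff]
        exact fun h => H.2 (SetLike.coe_injective h)
      have := Set.ncard_lt_ncard hlt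
      rw [Set.ncard_univ] at this
      exact_mod_cast this
    simpa using tendsto_const_nhds.sub h
  refine tendsto_of_tendsto_of_tendsto_of_le_of_le hlim tendsto_const_nhds (fun n => ?_) fun n => ?_
  · have h : (Nat.card G : ℝ) ^ n ≤
        Nat.card {F : (Fin n → ℤ_[p]) →ₗ[ℤ_[p]] G // Function.Surjective F} +
        ∑ H : {H : Submodule ℤ_[p] G // H ≠ ⊤}, (Nat.card H.1 : ℝ) ^ n := by
      exact_mod_cast card_pow_le_card_surjective_add (p := p) (G := G) n
    have hn : (0 : ℝ) < (Nat.card G : ℝ) ^ n := by positivity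
    simp only [div_pow, inv_pow, ← Finset.sum_div]
    rw [← div_eq_mul_inv, sub_le_iff_le_add, ← add_div, one_le_div hn]
    exact h
  · have h : (Nat.card {F : (Fin n → ℤ_[p]) →ₗ[ℤ_[p]] G // Function.Surjective F} : ℝ) ≤
        (Nat.card G : ℝ) ^ n := by
      rw [← Nat.cast_pow, ← card_linearMap_fin (p := p)]
      exact_mod_cast Finite.card_subtype_le _
    have hn : (0 : ℝ) < (Nat.card G : ℝ) ^ n := by positivity
    simp only [inv_pow]
    rw [← div_eq_mul_inv]
    exact (div_le_one hn).2 h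

end Expectation

/-- A nonzero kernel vector of a matrix over `ℤ_[p]` can be divided by a power of `p` to have a
unit coordinate. -/
theorem exists_isUnit_coord_of_not_injective {p : ℕ} [Fact p.Prime] {m n : ℕ}
    (M : Matrix (Fin m) (Fin n) ℤ_[p]) (hM : ¬ Function.Injective M.mulVecLin) :
    ∃ v : Fin n → ℤ_[p], M.mulVec v = 0 ∧ ∃ j, IsUnit (v j) := by
  rw [← LinearMap.ker_eq_bot, Submodule.eq_bot_iff] at hM
  push Not at hM
  obtain ⟨w, hw, hw0⟩ := hM
  have hw : M.mulVec w = 0 := hw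
  obtain ⟨i₀, hi₀⟩ := Function.ne_iff.1 hw0
  have : Nonempty (Fin n) := ⟨i₀⟩
  obtain ⟨j, hj⟩ := Finite.exists_max fun i => ‖w i‖
  have hwj : w j ≠ 0 := by
    rw [← norm_pos_iff]
    exact (norm_pos_iff.2 hi₀).trans_le (hj i₀)
  have hdvd : ∀ i, (p : ℤ_[p]) ^ (w j).valuation ∣ w i := by
    intro i
    rw [← Ideal.mem_span_singleton, ← PadicInt.norm_le_pow_iff_mem_span_pow,
      ← PadicInt.norm_eq_zpow_neg_valuation hwj]
    exact hj i
  choose v hv using hdvd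
  have hp : (p : ℤ_[p]) ^ (w j).valuation ≠ 0 := pow_ne_zero _ PadicInt.prime_p.ne_zero
  have hwv : w = (p : ℤ_[p]) ^ (w j).valuation • v := funext hv
  refine ⟨v, ?_, j, ?_⟩
  · rw [hwv, Matrix.mulVec_smul] at hw
    exact (smul_eq_zero.1 hw).resolve_left hp
  · have h1 := PadicInt.unitCoeff_spec hwj
    have h2 : v j = PadicInt.unitCoeff hwj := by
      apply mul_left_cancel₀ hp
      rw [← hv j, mul_comm]
      exact h1
    rw [h2]
    exact Units.isUnit _

theorem totient_le_card_surjective_of_not_injective {p : ℕ} [Fact p.Prime] {m n : ℕ} (k : ℕ)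
    [Module ℤ_[p] (ZMod (p ^ k))]
    (hsmul : ∀ (c : ℤ_[p]) (x : ZMod (p ^ k)), c • x = PadicInt.toZModPow k c * x)
    (M : Matrix (Fin m) (Fin n) ℤ_[p]) (hM : ¬ Function.Injective M.mulVecLin) :
    (p ^ k).totient ≤ Nat.card
      {F : {F : (Fin n → ℤ_[p]) →ₗ[ℤ_[p]] ZMod (p ^ k) // Function.Surjective F} //
        ∀ i, F.1 (M i) = 0} := by
  have : NeZero (p ^ k) := ⟨pow_ne_zero _ (Fact.out : p.Prime).ne_zero⟩
  obtain ⟨v, hv, j, hj⟩ := exists_isUnit_coord_of_not_injective M hM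
  let F : (ZMod (p ^ k))ˣ → (Fin n → ℤ_[p]) →ₗ[ℤ_[p]] ZMod (p ^ k) := fun a =>
    { toFun := fun x => a * PadicInt.toZModPow k (x ⬝ᵥ v)
      map_add' := fun x y => by rw [add_dotProduct, map_add, mul_add]
      map_smul' := fun c x => by
        rw [smul_dotProduct, smul_eq_mul, map_mul, RingHom.id_apply, hsmul]
        ring }
  have hF : ∀ a x, F a x = a * PadicInt.toZModPow k (x ⬝ᵥ v) := fun _ _ => rfl
  obtain ⟨b, hb⟩ := hj
  have he : Pi.single j (↑b⁻¹ : ℤ_[p]) ⬝ᵥ v = 1 := by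
    rw [single_dotProduct, ← hb, Units.inv_mul]
  have hsurj : ∀ a, Function.Surjective (F a) := by
    intro a y
    obtain ⟨c, hc⟩ := ZMod.ringHom_surjective (PadicInt.toZModPow (p := p) k) (↑a⁻¹ * y)
    refine ⟨c • Pi.single j (↑b⁻¹ : ℤ_[p]), ?_⟩
    rw [hF, smul_dotProduct, he, smul_eq_mul, mul_one, hc, Units.mul_inv_cancel_left]
  have hzero : ∀ a i, F a (M i) = 0 := by
    intro a i
    have : M i ⬝ᵥ v = 0 := congrFun hv i
    rw [hF, this, map_zero, mul_zero]
  rw [← ZMod.card_units_eq_totient, ← Nat.card_eq_fintype_card]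
  refine Nat.card_le_card_of_injective (fun a => ⟨⟨F a, hsurj a⟩, hzero a⟩) ?_
  intro a a' h
  have h : F a = F a' := congrArg (fun F => F.1.1) h
  have := LinearMap.congr_fun h (Pi.single j (↑b⁻¹ : ℤ_[p]))
  rw [hF, hF, he, map_one, mul_one, mul_one] at this
  exact Units.ext this

/-- Almost every tall (or square) matrix is injective: a matrix which is not has many surjections
from the cokernel of its transpose to `ZMod (p ^ k)`, and the expected number of these is at
most `1`. -/
theorem ae_injective_mulVecLin (p : ℕ) [Fact p.Prime] (u n : ℕ) :
    ∀ᵐ M ∂(padicMatrixHaar p (n + u) n), Function.Injective M.mulVecLin := by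
  set μ := padicMatrixHaar p (n + u) n
  have hbound : ∀ k : ℕ, ((p ^ k).totient : ℝ) *
      μ.real {M | ¬ Function.Injective M.mulVecLin} ≤ 1 := by
    intro k
    let : Module ℤ_[p] (ZMod (p ^ k)) := Module.compHom _ (PadicInt.toZModPow (p := p) k)
    have : NeZero (p ^ k) := ⟨pow_ne_zero _ (Fact.out : p.Prime).ne_zero⟩
    have hsmul : ∀ (c : ℤ_[p]) (x : ZMod (p ^ k)), c • x = PadicInt.toZModPow k c * x :=
      fun _ _ => rfl
    have hG : ∀ g : ZMod (p ^ k), (p : ℤ_[p]) ^ k • g = 0 := by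
      intro g
      rw [hsmul, map_pow, map_natCast, ← Nat.cast_pow, ZMod.natCast_self, zero_mul]
    have hmarkov := mul_meas_ge_le_integral_of_nonneg
      (ae_of_all _ fun M => Nat.cast_nonneg _)
      (integrable_card_surjective_vanishing hG (n + u) n) ((p ^ k).totient : ℝ)
    rw [integral_card_surjective_vanishing hG] at hmarkov
    have hmono : μ.real {M | ¬ Function.Injective M.mulVecLin} ≤ μ.real _ :=
      measureReal_mono (μ := μ) (s₂ := {M | ((p ^ k).totient : ℝ) ≤ Nat.card
        {F : {F : (Fin n → ℤ_[p]) →ₗ[ℤ_[p]] ZMod (p ^ k) // Function.Surjective F} //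
          ∀ i, F.1 (M i) = 0}})
        (fun M hM => Set.mem_ofPred.2
          (Nat.cast_le.2 (totient_le_card_surjective_of_not_injective k hsmul M hM)))
    refine (mul_le_mul_of_nonneg_left hmono (Nat.cast_nonneg _)).trans (hmarkov.trans ?_)
    have h : (Nat.card {F : (Fin n → ℤ_[p]) →ₗ[ℤ_[p]] ZMod (p ^ k) // Function.Surjective F} : ℝ) ≤
        (Nat.card (ZMod (p ^ k)) : ℝ) ^ n := by
      rw [← Nat.cast_pow, ← card_linearMap_fin (p := p)]
      exact_mod_cast Finite.card_subtype_le _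
    have hone : (1 : ℝ) ≤ Nat.card (ZMod (p ^ k)) := by
      exact_mod_cast Nat.card_pos (α := ZMod (p ^ k))
    rw [inv_pow, ← div_eq_mul_inv]
    exact (div_le_one (by positivity)).2
      (h.trans (pow_le_pow_right₀ hone (Nat.le_add_right n u)))
  have hzero : μ.real {M | ¬ Function.Injective M.mulVecLin} = 0 := by
    by_contra hne
    have hpos := lt_of_le_of_ne measureReal_nonneg (Ne.symm hne)
    obtain ⟨N, hN⟩ := exists_nat_gt (μ.real {M | ¬ Function.Injective M.mulVecLin})⁻¹
    have hp := (Fact.out : p.Prime)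
    have htot : N ≤ (p ^ (N + 1)).totient := by
      rw [Nat.totient_prime_pow_succ hp]
      exact (Nat.lt_pow_self hp.one_lt).le.trans
        (Nat.le_mul_of_pos_right _ (Nat.sub_pos_of_lt hp.one_lt))
    have h1 : (1 : ℝ) < N * μ.real {M | ¬ Function.Injective M.mulVecLin} :=
      (inv_lt_iff_one_lt_mul₀ hpos).1 hN
    have h2 : (N : ℝ) * μ.real {M | ¬ Function.Injective M.mulVecLin} ≤ 1 :=
      (mul_le_mul_of_nonneg_right (Nat.cast_le.2 htot) hpos.le).trans (hbound (N + 1))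
    exact absurd h1 h2.not_gt
  rw [ae_iff]
  exact (measureReal_eq_zero_iff).1 hzero

theorem limit_expected_surjections_torsion (p : ℕ) [Fact p.Prime] (u : ℕ)
    (G : Type) [AddCommGroup G] [Module ℤ_[p] G] [Finite G]
    (hG : ∃ k : ℕ, Nat.card G = p ^ k) :
    Tendsto
      (fun n : ℕ =>
        ∫ M : Matrix (Fin (n + u)) (Fin n) ℤ_[p],
          (Nat.card {f :
            pPrimaryTorsion p ((Fin (n + u) → ℤ_[p]) ⧸ LinearMap.range M.mulVecLin)
              →ₗ[ℤ_[p]] G // Function.Surjective f} : ℝ)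
          ∂(padicMatrixHaar p (n + u) n))
      atTop (nhds (((Nat.card G : ℝ))⁻¹ ^ u)) := by
  obtain ⟨k, hk⟩ := hG
  have hG : ∀ g : G, (p : ℤ_[p]) ^ k • g = 0 := by
    intro g
    rw [← Nat.cast_pow, ← hk, Nat.cast_smul_eq_nsmul]
    exact card_nsmul_eq_zero'
  have hint : ∀ n : ℕ, ∫ M : Matrix (Fin (n + u)) (Fin n) ℤ_[p],
      (Nat.card {f :
        pPrimaryTorsion p ((Fin (n + u) → ℤ_[p]) ⧸ LinearMap.range M.mulVecLin)
          →ₗ[ℤ_[p]] G // Function.Surjective f} : ℝ) ∂(padicMatrixHaar p (n + u) n) =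
      (Nat.card {F : (Fin n → ℤ_[p]) →ₗ[ℤ_[p]] G // Function.Surjective F} : ℝ) *
        ((Nat.card G : ℝ)⁻¹) ^ n * ((Nat.card G : ℝ)⁻¹) ^ u := by
    intro n
    rw [mul_assoc, ← pow_add, ← integral_card_surjective_vanishing hG]
    refine integral_congr_ae ?_
    filter_upwards [ae_injective_mulVecLin p u n] with M hM
    rw [card_surjective_pPrimaryTorsion G M hM]
  simp_rw [hint]
  simpa using (tendsto_card_surjective_div p G).mul_const (((Nat.card G : ℝ)⁻¹) ^ u)
end
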